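/- An EFX allocation exists if and only if there exists y ∈ [−M, 0]^{m×n}, where M = 2V + 1 and V = Σ_{ℓ,i} v_{ℓi}, satisfying y_{kj} − h(y_k) + A_{kj}(y) ≤ 0 for every good k and every agent j. -/

import Mathlib

/-- Max of a row: `h(z) = max_r z_r` (realized as `sSup` of the finite range). -/
noncomputable def rowMax {n : ℕ} (z : Fin n → ℝ) : ℝ := sSup (Set.range z)

/-- The continuous-extension upper bound `g(x,λ)` from the paper. -/
noncomputable def gfun {m n : ℕ} (v x : Fin m → Fin n → ℝ) (lam : ℝ) : ℝ :=
  (1 / lam) * Real.log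
    (∑ p ∈ Finset.univ.filter (fun p : Fin n × Fin n => p.1 ≠ p.2),
      ∑ k : Fin m, x k p.2 *
        ∏ ℓ ∈ Finset.univ.erase k,
          (1 - x ℓ p.1 - x ℓ p.2 + x ℓ p.1 * Real.exp (-lam * v ℓ p.1)
            + x ℓ p.2 * Real.exp (lam * v ℓ p.1)))

/-- `X` is an EFX allocation: a partition of the goods such that for all agents
`i, j` and every good `k ∈ X_j`, `Σ_{ℓ∈X_i} v_{ℓi} ≥ Σ_{ℓ∈X_j} v_{ℓi} − v_{ki}`. -/
def IsEFX {m n : ℕ} (v : Fin m → Fin n → ℝ) (X : Fin n → Finset (Fin m)) : Prop :=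
  (∀ i j, i ≠ j → Disjoint (X i) (X j)) ∧
  (Finset.univ.biUnion X = (Finset.univ : Finset (Fin m))) ∧
  (∀ i j : Fin n, ∀ k ∈ X j, (∑ ℓ ∈ X i, v ℓ i) ≥ (∑ ℓ ∈ X j, v ℓ i) - v k i)

/-- `A_{kj}(y) = max_{i≠j} Σ_{ℓ≠k} ( h(y_ℓ + v_{ℓi}(e_j − e_i)) − h(y_ℓ) )`. -/
noncomputable def Amap {m n : ℕ} (v y : Fin m → Fin n → ℝ) (k : Fin m) (j : Fin n) : ℝ :=
  sSup { z : ℝ | ∃ i : Fin n, i ≠ j ∧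
    z = ∑ ℓ ∈ Finset.univ.erase k,
      (rowMax (fun r => y ℓ r +
          v ℓ i * ((if r = j then (1 : ℝ) else 0) - (if r = i then (1 : ℝ) else 0)))
        - rowMax (y ℓ)) }

/-- The objective `f(y)` of Theorem `thm:f-y`; note that
`max{ y_{ℓi} − v_{ℓi}, y_{ℓj} + v_{ℓi}, max_{r∉{i,j}} y_{ℓr} }` is exactly the max of
the row `y_ℓ + v_{ℓi}(e_j − e_i)` (and when `n = 2` the innermost max is absent). -/
noncomputable def fobj {m n : ℕ} (v y : Fin m → Fin n → ℝ) : ℝ :=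
  sSup { z : ℝ | ∃ i j : Fin n, i ≠ j ∧ ∃ k : Fin m,
      z = y k j + ∑ ℓ ∈ Finset.univ.erase k,
        rowMax (fun r => y ℓ r +
          v ℓ i * ((if r = j then (1 : ℝ) else 0) - (if r = i then (1 : ℝ) else 0))) }
    - ∑ ℓ, rowMax (y ℓ)

open Finset

lemma le_rowMax {n : ℕ} (z : Fin n → ℝ) (r : Fin n) : z r ≤ rowMax z :=
  le_csSup (Set.finite_range z).bddAbove ⟨r, rfl⟩

lemma rowMax_le {n : ℕ} [Nonempty (Fin n)] {z : Fin n → ℝ} {c : ℝ} (h : ∀ r, z r ≤ c) :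
    rowMax z ≤ c :=
  csSup_le (Set.range_nonempty z) (by rintro _ ⟨r, rfl⟩; exact h r)

lemma exists_eq_rowMax {n : ℕ} [Nonempty (Fin n)] (z : Fin n → ℝ) : ∃ r, z r = rowMax z :=
  (Set.range_nonempty z).csSup_mem (Set.finite_range z)

lemma le_Amap {m n : ℕ} (v y : Fin m → Fin n → ℝ) (k : Fin m) {i j : Fin n} (hij : i ≠ j) :
    ∑ ℓ ∈ univ.erase k,
      (rowMax (fun r => y ℓ r +
          v ℓ i * ((if r = j then (1 : ℝ) else 0) - (if r = i then (1 : ℝ) else 0)))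
        - rowMax (y ℓ)) ≤ Amap v y k j := by
  refine le_csSup (Set.Finite.bddAbove ?_) ⟨i, hij, rfl⟩
  refine (Set.finite_range (fun i : Fin n => ∑ ℓ ∈ univ.erase k,
      (rowMax (fun r => y ℓ r +
          v ℓ i * ((if r = j then (1 : ℝ) else 0) - (if r = i then (1 : ℝ) else 0)))
        - rowMax (y ℓ)))).subset ?_
  rintro _ ⟨i, -, rfl⟩
  exact ⟨i, rfl⟩

lemma Amap_le {m n : ℕ} (hn : 2 ≤ n) (v y : Fin m → Fin n → ℝ) (k : Fin m) (j : Fin n) {c : ℝ}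
    (h : ∀ i, i ≠ j → ∑ ℓ ∈ univ.erase k,
      (rowMax (fun r => y ℓ r +
          v ℓ i * ((if r = j then (1 : ℝ) else 0) - (if r = i then (1 : ℝ) else 0)))
        - rowMax (y ℓ)) ≤ c) : Amap v y k j ≤ c := by
  have : Nontrivial (Fin n) := Fin.nontrivial_iff_two_le.2 hn
  obtain ⟨i, hi⟩ := exists_ne j
  refine csSup_le ⟨_, i, hi, rfl⟩ ?_
  rintro _ ⟨i, hi, rfl⟩
  exact h i hi

/-- The EFX condition for the allocation that gives each good `ℓ` to agent `a ℓ`. -/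
lemma isEFX_fiber_iff {m n : ℕ} {v : Fin m → Fin n → ℝ} (hv : ∀ k i, 0 ≤ v k i)
    (a : Fin m → Fin n) :
    IsEFX v (fun i => univ.filter (a · = i)) ↔ ∀ k i, i ≠ a k →
      ∑ ℓ ∈ univ.erase k,
        ((if a ℓ = a k then v ℓ i else 0) - (if a ℓ = i then v ℓ i else 0)) ≤ 0 := by
  have key (k : Fin m) (i : Fin n) (hi : i ≠ a k) :
      ∑ ℓ ∈ univ.erase k, ((if a ℓ = a k then v ℓ i else 0) - (if a ℓ = i then v ℓ i else 0)) =
        ∑ ℓ with a ℓ = a k, v ℓ i - v k i - ∑ ℓ with a ℓ = i, v ℓ i := by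
    rw [sum_erase_eq_sub (mem_univ k), sum_sub_distrib, sum_filter, sum_filter, if_pos rfl,
      if_neg hi.symm]
    ring
  constructor
  · rintro ⟨-, -, h⟩ k i hi
    have := h i (a k) k (by simp)
    rw [key k i hi]
    linarith
  · refine fun h => ⟨fun i j hij => ?_, by ext; simp, fun i j k hk => ?_⟩
    · exact disjoint_filter.2 fun ℓ _ hi hj => hij (hi.symm.trans hj)
    · obtain rfl : a k = j := by simpa using hk
      by_cases hi : i = a k
      · subst hi
        linarith [hv k (a k)]
      · have := h k i hi
        rw [key k i hi] at this
        linarith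

lemma exists_fiber_of_isEFX {m n : ℕ} {v : Fin m → Fin n → ℝ} {X : Fin n → Finset (Fin m)}
    (hX : IsEFX v X) : ∃ a : Fin m → Fin n, X = fun i => univ.filter (a · = i) := by
  obtain ⟨hd, hu, -⟩ := hX
  have hex (ℓ : Fin m) : ∃ i, ℓ ∈ X i := by
    have : ℓ ∈ univ.biUnion X := hu ▸ mem_univ ℓ
    simpa using this
  choose a ha using hex
  refine ⟨a, funext fun i => Finset.ext fun ℓ => ?_⟩
  simp only [mem_filter, mem_univ, true_and]
  refine ⟨fun h => ?_, fun h => h ▸ ha ℓ⟩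
  by_contra hne
  exact disjoint_left.1 (hd _ _ hne) (ha ℓ) h

/-- An EFX allocation exists if and only if there exists
`y ∈ [−M, 0]^{m×n}`, where `M = 2V + 1` and `V = Σ_{ℓ,i} v_{ℓi}`, satisfying
`y_{kj} − h(y_k) + A_{kj}(y) ≤ 0` for every good `k` and every agent `j`. -/
theorem stmt_15 (m n : ℕ) (hm : 1 ≤ m) (hn : 2 ≤ n)
    (v : Fin m → Fin n → ℝ) (hv : ∀ k i, 0 ≤ v k i) :
    (∃ X : Fin n → Finset (Fin m), IsEFX v X) ↔
      (∃ y : Fin m → Fin n → ℝ,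
        (∀ k j, y k j ∈ Set.Icc (-(2 * (∑ ℓ : Fin m, ∑ i : Fin n, v ℓ i) + 1)) 0) ∧
        (∀ k j, y k j - rowMax (y k) + Amap v y k j ≤ 0)) := by
  have : Nonempty (Fin n) := ⟨⟨0, by omega⟩⟩
  constructor
  · rintro ⟨X, hX⟩
    obtain ⟨a, rfl⟩ := exists_fiber_of_isEFX hX
    rw [isEFX_fiber_iff hv] at hX
    set V := ∑ ℓ : Fin m, ∑ i : Fin n, v ℓ i
    have hvV (ℓ : Fin m) (i : Fin n) : v ℓ i ≤ V :=
      (single_le_sum (f := v ℓ) (fun i _ => hv ℓ i) (mem_univ i)).trans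
        (single_le_sum (f := fun ℓ => ∑ i, v ℓ i)
          (fun ℓ _ => sum_nonneg fun i _ => hv ℓ i) (mem_univ ℓ))
    have hV : 0 ≤ V := sum_nonneg fun ℓ _ => sum_nonneg fun i _ => hv ℓ i
    let y : Fin m → Fin n → ℝ := fun ℓ r => if r = a ℓ then 0 else -(2 * V + 1)
    have hy (ℓ : Fin m) : rowMax (y ℓ) = 0 := by
      refine le_antisymm (rowMax_le fun r => ?_) ?_
      · simp only [y]
        split_ifs <;> linarith
      · simpa [y] using le_rowMax (y ℓ) (a ℓ)
    refine ⟨y, fun k j => ?_, fun k j => ?_⟩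
    · simp only [y, Set.mem_Icc]
      split_ifs <;> constructor <;> linarith
    rw [hy]
    by_cases hj : j = a k
    · have : Amap v y k j ≤ 0 := by
        refine Amap_le hn v y k j fun i hi => ?_
        subst hj
        refine (sum_le_sum fun ℓ _ => ?_).trans (hX k i hi)
        rw [hy, sub_zero]
        refine rowMax_le fun r => ?_
        have h1 := hv ℓ i
        have h2 := hvV ℓ i
        simp only [y]
        split_ifs <;> first | linarith | simp_all
      simpa [y, hj] using this
    · have : Amap v y k j ≤ V := by
        refine Amap_le hn v y k j fun i hi => ?_
        calc _ ≤ ∑ ℓ ∈ univ.erase k, v ℓ i := sum_le_sum fun ℓ _ => ?_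
          _ ≤ ∑ ℓ, v ℓ i := sum_le_sum_of_subset_of_nonneg (subset_univ _) fun ℓ _ _ => hv ℓ i
          _ ≤ V := sum_le_sum fun ℓ _ => single_le_sum (fun i _ => hv ℓ i) (mem_univ i)
        rw [hy, sub_zero]
        refine rowMax_le fun r => ?_
        have h1 := hv ℓ i
        simp only [y]
        split_ifs <;> linarith
      simp only [y, if_neg hj]
      linarith
  · rintro ⟨y, -, hy⟩
    choose a ha using fun ℓ => exists_eq_rowMax (y ℓ)
    refine ⟨_, (isEFX_fiber_iff hv a).2 fun k i hi => ?_⟩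
    have hk := hy k (a k)
    rw [ha, sub_self, zero_add] at hk
    refine (sum_le_sum fun ℓ _ => ?_).trans ((le_Amap v y k hi).trans hk)
    have hr := le_rowMax (fun r => y ℓ r + v ℓ i *
      ((if r = a k then (1 : ℝ) else 0) - (if r = i then (1 : ℝ) else 0))) (a ℓ)
    simp only [ha] at hr
    have h1 := hv ℓ i
    split_ifs at hr ⊢ <;> linarith
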